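/- arXiv:1710.07719 — 2 statements merged into one kernel-verified Lean document; each statement's English description precedes it below -/
import Mathlib

section
/- There is a constant M < ∞ depending only on ε and δ such that for all (n,k) ∈ 𝒯, the stopping time τ associated with the Budget-Ratio policy satisfies E[τ] ≥ n − M. -/
open MeasureTheory ProbabilityTheory Finset

noncomputable section

namespace MultiSecretary

variable {Ω : Type*}

/-- `Z_j^r`: the number of candidates with ability `aj` among the first `r`
(candidates are indexed `0, 1, …`, so `X 0, …, X (r-1)` are the first `r`). -/
def Zc (X : ℕ → Ω → ℝ) (aj : ℝ) (r : ℕ) (ω : Ω) : ℝ :=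
  ∑ t ∈ range r, if X t ω = aj then 1 else 0

/-- `F̄(a_j) = f_1 + ⋯ + f_{j-1}`. -/
def Fbar (f : ℕ → ℝ) (j : ℕ) : ℝ := ∑ i ∈ Icc 1 (j - 1), f i

/-- The offline-sort count `𝔖_j^r = min { Z_j^r , (k - ∑_{i<j} Z_i^r)_+ }`. -/
def Soff (a : ℕ → ℝ) (X : ℕ → Ω → ℝ) (k r j : ℕ) (ω : Ω) : ℝ :=
  min (Zc X (a j) r ω) (max ((k : ℝ) - ∑ i ∈ Icc 1 (j - 1), Zc X (a i) r ω) 0)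

/-- The offline value `V_off^*(n,k) = ∑_j a_j E[𝔖_j^n]`. -/
def Voff [MeasurableSpace Ω] (μ : Measure Ω) (m : ℕ) (a : ℕ → ℝ) (X : ℕ → Ω → ℝ)
    (n k : ℕ) : ℝ :=
  ∑ j ∈ Icc 1 m, a j * ∫ ω, Soff a X k n j ω ∂μ

/-- The σ-field `𝓕_t` generated by the first `t` pairs `(X_s, U_s)`. -/
def Fil (X U : ℕ → Ω → ℝ) (t : ℕ) : MeasurableSpace Ω :=
  MeasurableSpace.comap (fun ω => fun s : Fin t => (X s ω, U s ω)) inferInstance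

/-- A feasible online policy for the `(n,k)` multi-secretary problem: `σp t` is the
(0/1-valued) decision about candidate `t` (0-indexed), measurable with respect to
`𝓕_{t+1} = σ(X_0,U_0,…,X_t,U_t)`, and at most `k` candidates are selected. -/
def IsPolicy (X U : ℕ → Ω → ℝ) (n k : ℕ) (σp : ℕ → Ω → ℕ) : Prop :=
  (∀ t ω, σp t ω ≤ 1) ∧
  (∀ t, Measurable[Fil X U (t + 1)] (σp t)) ∧
  (∀ ω, ∑ t ∈ range n, σp t ω ≤ k)

/-- The value `V_on^π(n,k)` of an online policy. -/
def Von [MeasurableSpace Ω] (μ : Measure Ω) (X : ℕ → Ω → ℝ) (n : ℕ) (σp : ℕ → Ω → ℕ) : ℝ :=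
  ∫ ω, (∑ t ∈ range n, X t ω * (σp t ω : ℝ)) ∂μ

/-- `V_on^*(n,k)`, the optimal value over feasible online policies. -/
def VonStar [MeasurableSpace Ω] (μ : Measure Ω) (X U : ℕ → Ω → ℝ) (n k : ℕ) : ℝ :=
  sSup {v : ℝ | ∃ σp, IsPolicy X U n k σp ∧ v = Von μ X n σp}

/-- `S_j^{π,r}`: the number of `a_j`-candidates selected by policy `π` among the first `r`. -/
def Spol (a : ℕ → ℝ) (X : ℕ → Ω → ℝ) (σp : ℕ → Ω → ℕ) (j r : ℕ) (ω : Ω) : ℝ :=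
  ∑ t ∈ range r, (σp t ω : ℝ) * (if X t ω = a j then 1 else 0)

/-- The Budget-Ratio thresholds: `T_1 = 0`, `T_j = (F̄(a_j)+F̄(a_{j+1}))/2` for `j ≥ 2`. -/
def Tthr (f : ℕ → ℝ) (j : ℕ) : ℝ := if j = 1 then 0 else (Fbar f j + Fbar f (j + 1)) / 2

/-- The index `j ∈ [m]` with `T_j ≤ x < T_{j+1}` (with `T_{m+1} = ∞`), i.e. the largest
`j ∈ [m]` with `T_j ≤ x`. -/
def jBR (m : ℕ) (f : ℕ → ℝ) (x : ℝ) : ℕ :=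
  ((Icc 1 m).filter fun j => Tthr f j ≤ x).sup id

/-- The remaining-budget process `K_t` of the Budget-Ratio policy: `K_0 = k`, and the
candidate `X_t` (presented at time `t+1`, 1-indexed) is selected iff `K_t > 0` and
`X_t > a_{j+1}` where `T_j ≤ K_t/(n-t) < T_{j+1}` (for `j = m`, i.e. `T_m ≤ K_t/(n-t)`,
every candidate is selected since `T_{m+1} = ∞` and `a_{m+1} < a_m`). -/
def Kbr (m : ℕ) (a f : ℕ → ℝ) (X : ℕ → Ω → ℝ) (n k : ℕ) : ℕ → Ω → ℕ
  | 0, _ => k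
  | t + 1, ω =>
    Kbr m a f X n k t ω -
      (if 0 < Kbr m a f X n k t ω ∧
          (jBR m f ((Kbr m a f X n k t ω : ℝ) / ((n : ℝ) - t)) = m ∨
            a (jBR m f ((Kbr m a f X n k t ω : ℝ) / ((n : ℝ) - t)) + 1) < X t ω)
        then 1 else 0)

/-- The selection decisions `σ^br` of the Budget-Ratio policy (0-indexed candidates). -/
def σbr (m : ℕ) (a f : ℕ → ℝ) (X : ℕ → Ω → ℝ) (n k : ℕ) (t : ℕ) (ω : Ω) : ℕ :=
  Kbr m a f X n k t ω - Kbr m a f X n k (t + 1) ω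

/-- The Bernoulli selection indicators `B_t` of a non-adaptive policy `p = (p_{j,t})`. -/
def Bna (m : ℕ) (a : ℕ → ℝ) (p : ℕ → ℕ → ℝ) (X U : ℕ → Ω → ℝ) (t : ℕ) (ω : Ω) : ℝ :=
  ∑ j ∈ Icc 1 m, if U t ω ≤ p j t ∧ X t ω = a j then 1 else 0

/-- The stopping time `ν = min{ r ≥ 1 : B_1 + ⋯ + B_r ≥ k or r ≥ n }` of a
non-adaptive policy. -/
def nuNA (m : ℕ) (a : ℕ → ℝ) (p : ℕ → ℕ → ℝ) (X U : ℕ → Ω → ℝ) (n k : ℕ) (ω : Ω) : ℕ :=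
  sInf {r : ℕ | 1 ≤ r ∧ ((k : ℝ) ≤ ∑ t ∈ range r, Bna m a p X U t ω ∨ n ≤ r)}

/-- The value `V_on^π(n,k) = ∑_j a_j E[∑_{t ≤ ν} B_t 1(X_t = a_j)]` of a non-adaptive policy. -/
def VonNA [MeasurableSpace Ω] (μ : Measure Ω) (m : ℕ) (a : ℕ → ℝ) (p : ℕ → ℕ → ℝ)
    (X U : ℕ → Ω → ℝ) (n k : ℕ) : ℝ :=
  ∑ j ∈ Icc 1 m, a j *
    ∫ ω, (∑ t ∈ range (nuNA m a p X U n k ω), if X t ω = a j then Bna m a p X U t ω else 0) ∂μ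

/-- `V_na^*(n,k)`: the optimal value over non-adaptive policies. -/
def VnaStar [MeasurableSpace Ω] (μ : Measure Ω) (m : ℕ) (a : ℕ → ℝ) (X U : ℕ → Ω → ℝ)
    (n k : ℕ) : ℝ :=
  sSup {v : ℝ | ∃ p : ℕ → ℕ → ℝ,
    (∀ j t, 0 ≤ p j t ∧ p j t ≤ 1) ∧ v = VonNA μ m a p X U n k}

/-- The deterministic relaxation `DR(n,k)`. -/
def DRval (m : ℕ) (a f : ℕ → ℝ) (n k : ℕ) : ℝ :=
  sSup {v : ℝ | ∃ s : ℕ → ℝ,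
    (∀ j ∈ Icc 1 m, 0 ≤ s j ∧ s j ≤ (n : ℝ) * f j) ∧
    (∑ j ∈ Icc 1 m, s j) ≤ (k : ℝ) ∧ v = ∑ j ∈ Icc 1 m, a j * s j}

/-- The optimal solution `s_j^* = min{ n f_j, (k - n F̄(a_j))_+ }` of the deterministic
relaxation. -/
def sStar (f : ℕ → ℝ) (n k j : ℕ) : ℝ :=
  min ((n : ℝ) * f j) (max ((k : ℝ) - (n : ℝ) * Fbar f j) 0)

/-- `J0Spec m f n k j` says that `j = j₀(n,k)`, the action index of `(n,k)`. -/
def J0Spec (m : ℕ) (f : ℕ → ℝ) (n k j : ℕ) : Prop :=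
  (j = 1 ∧ (k : ℝ) / (n : ℝ) < f 1 + f 2 / 2) ∨
  (1 ≤ j ∧ j + 1 ≤ m ∧ Fbar f j + f j / 2 ≤ (k : ℝ) / (n : ℝ) ∧
    (k : ℝ) / (n : ℝ) < Fbar f (j + 2) - f (j + 1) / 2) ∨
  (j = m ∧ 1 - f m / 2 ≤ (k : ℝ) / (n : ℝ))

/-- The budget ratio `K_t / (n - t)`. -/
def ratio (K : ℕ → Ω → ℕ) (n t : ℕ) (ω : Ω) : ℝ := (K t ω : ℝ) / ((n : ℝ) - t)

/-- The time `τ₀` at which the budget ratio first enters the `δ/2`-orbit of a threshold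
(or the deterministic time `n - 2δ⁻¹ - 1` is reached). -/
def tau0 (m : ℕ) (f : ℕ → ℝ) (δ : ℝ) (K : ℕ → Ω → ℕ) (n : ℕ) (ω : Ω) : ℕ :=
  sInf {t : ℕ |
    (∃ j ∈ Icc 1 m, |ratio K n t ω - Tthr f j| ≤ δ / 2) ∨ (n : ℝ) - 2 / δ - 1 ≤ (t : ℝ)}

/-- The index `j(τ₀)` of the threshold entered at time `τ₀` (set to `m+1`, corresponding to
`T_{j(τ₀)} = ∞`, when `τ₀ ≥ n - 2δ⁻¹ - 1`). -/
def jTau0 (m : ℕ) (f : ℕ → ℝ) (δ : ℝ) (K : ℕ → Ω → ℕ) (n : ℕ) (ω : Ω) : ℕ :=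
  if (tau0 m f δ K n ω : ℝ) < (n : ℝ) - 2 / δ - 1 then
    sInf {j : ℕ | j ∈ Icc 1 m ∧ |ratio K n (tau0 m f δ K n ω) ω - Tthr f j| ≤ δ / 2}
  else m + 1

/-- The exit time `τ = inf{ t > τ₀ : |K_t/(n-t) - T_{j(τ₀)}| > δ or t ≥ n - 2δ⁻¹ - 1 }`
(for `j(τ₀) = m + 1`, i.e. `T_{j(τ₀)} = ∞`, the first condition is vacuous). -/
def tauBR (m : ℕ) (f : ℕ → ℝ) (δ : ℝ) (K : ℕ → Ω → ℕ) (n : ℕ) (ω : Ω) : ℕ :=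
  sInf {t : ℕ | tau0 m f δ K n ω < t ∧
    ((n : ℝ) - 2 / δ - 1 ≤ (t : ℝ) ∨
      (jTau0 m f δ K n ω ≤ m ∧ δ < |ratio K n t ω - Tthr f (jTau0 m f δ K n ω)|))}

/-- The deviation process `Y_u = K_{τ₀+u} - T_{j(τ₀)} (n - τ₀ - u)`. -/
def Ydev (m : ℕ) (f : ℕ → ℝ) (δ : ℝ) (K : ℕ → Ω → ℕ) (n : ℕ) (u : ℕ) (ω : Ω) : ℝ :=
  (K (tau0 m f δ K n ω + u) ω : ℝ) -
    Tthr f (jTau0 m f δ K n ω) * ((n : ℝ) - (tau0 m f δ K n ω : ℝ) - (u : ℝ))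

/-- The minimal mass `min{f_1, …, f_m}` of the ability distribution. -/
def minf (m : ℕ) (f : ℕ → ℝ) : ℝ := sInf {x : ℝ | ∃ j, 1 ≤ j ∧ j ≤ m ∧ x = f j}

/-- The standing model hypotheses of the multi-secretary problem: the abilities
`0 < a_m < ⋯ < a_1`, the probability mass function `f`, and the i.i.d. sequence of
abilities `X_t` together with the auxiliary i.i.d. uniform randomization variables `U_t`. -/
structure Model [MeasurableSpace Ω] (μ : Measure Ω) (m : ℕ) (a f : ℕ → ℝ)
    (X U : ℕ → Ω → ℝ) : Prop where
  hm : 1 ≤ m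
  ha_anti : ∀ j, 1 ≤ j → j < m → a (j + 1) < a j
  ha_pos : 0 < a m
  hf_pos : ∀ j, 1 ≤ j → j ≤ m → 0 < f j
  hf_sum : ∑ j ∈ Icc 1 m, f j = 1
  hprob : IsProbabilityMeasure μ
  hXmeas : ∀ t, Measurable (X t)
  hUmeas : ∀ t, Measurable (U t)
  hXdist : ∀ t j, 1 ≤ j → j ≤ m → μ {ω | X t ω = a j} = ENNReal.ofReal (f j)
  hUdist : ∀ t, μ.map (U t) = volume.restrict (Set.Icc (0 : ℝ) 1)
  hIndep : iIndepFun (fun t ω => (X t ω, U t ω)) μ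
  hXUIndep : ∀ t, IndepFun (X t) (U t) μ

/-- The standing model hypotheses with only the ability sequence `X` (no auxiliary
randomization). -/
structure ModelX [MeasurableSpace Ω] (μ : Measure Ω) (m : ℕ) (a f : ℕ → ℝ)
    (X : ℕ → Ω → ℝ) : Prop where
  hm : 1 ≤ m
  ha_anti : ∀ j, 1 ≤ j → j < m → a (j + 1) < a j
  ha_pos : 0 < a m
  hf_pos : ∀ j, 1 ≤ j → j ≤ m → 0 < f j
  hf_sum : ∑ j ∈ Icc 1 m, f j = 1
  hprob : IsProbabilityMeasure μ
  hXmeas : ∀ t, Measurable (X t)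
  hXdist : ∀ t j, 1 ≤ j → j ≤ m → μ {ω | X t ω = a j} = ENNReal.ofReal (f j)
  hIndep : iIndepFun X μ



/-! ### Thresholds -/

lemma Fbar_succ (f : ℕ → ℝ) (j : ℕ) (hj : 1 ≤ j) : Fbar f (j + 1) = Fbar f j + f j := by
  obtain ⟨i, rfl⟩ : ∃ i, j = i + 1 := ⟨j - 1, by omega⟩
  unfold Fbar
  simp only [Nat.add_sub_cancel]
  rw [Finset.sum_Icc_succ_top (by omega)]

lemma Fbar_mono (m : ℕ) (f : ℕ → ℝ) (hf : ∀ j, 1 ≤ j → j ≤ m → 0 < f j) (i j : ℕ)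
    (hij : i ≤ j) (hj : j ≤ m + 1) : Fbar f i ≤ Fbar f j := by
  unfold Fbar
  apply Finset.sum_le_sum_of_subset_of_nonneg
  · apply Finset.Icc_subset_Icc le_rfl; omega
  · intro x hx _
    rw [Finset.mem_Icc] at hx
    exact (hf x (by omega) (by omega)).le

lemma Fbar_top (m : ℕ) (f : ℕ → ℝ) (hs : ∑ j ∈ Icc 1 m, f j = 1) : Fbar f (m + 1) = 1 := by
  simpa [Fbar] using hs

lemma Tthr_eq (f : ℕ → ℝ) (j : ℕ) (hj : 2 ≤ j) : Tthr f j = Fbar f j + f j / 2 := by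
  unfold Tthr
  rw [if_neg (by omega), Fbar_succ f j (by omega)]; ring

lemma Tthr_one (f : ℕ → ℝ) : Tthr f 1 = 0 := by simp [Tthr]

lemma Tthr_nonneg (m : ℕ) (f : ℕ → ℝ) (hf : ∀ j, 1 ≤ j → j ≤ m → 0 < f j) (j : ℕ)
    (h1 : 1 ≤ j) (hj : j ≤ m) : 0 ≤ Tthr f j := by
  rcases Nat.lt_or_ge j 2 with h | h
  · obtain rfl : j = 1 := by omega
    rw [Tthr_one]
  · rw [Tthr_eq f j h]
    have := Fbar_mono m f hf 0 j (by omega) (by omega)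
    have h0 : Fbar f 0 = 0 := by simp [Fbar]
    have := hf j h1 hj
    linarith

/-- Upper drift gap. -/
lemma Tthr_add_le (m : ℕ) (f : ℕ → ℝ) (ε : ℝ) (he : 0 < ε)
    (hf : ∀ j, 1 ≤ j → j ≤ m → 2 * ε ≤ f j) (j : ℕ)
    (h1 : 1 ≤ j) (hj : j ≤ m) : Tthr f j + ε ≤ Fbar f (j + 1) := by
  have := hf j h1 hj
  rw [Fbar_succ f j h1]
  rcases Nat.lt_or_ge j 2 with h | h
  · obtain rfl : j = 1 := by omega
    rw [Tthr_one]
    have h0 : Fbar f 1 = 0 := by simp [Fbar]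
    linarith
  · rw [Tthr_eq f j h]
    linarith

lemma Tthr_le_one (m : ℕ) (f : ℕ → ℝ) (ε : ℝ) (he : 0 < ε)
    (hf : ∀ j, 1 ≤ j → j ≤ m → 2 * ε ≤ f j) (hs : ∑ j ∈ Icc 1 m, f j = 1) (j : ℕ)
    (h1 : 1 ≤ j) (hj : j ≤ m) : Tthr f j ≤ 1 := by
  have a1 := Tthr_add_le m f ε he hf j h1 hj
  have a2 := Fbar_mono m f (fun j h1 h2 => by linarith [hf j h1 h2]) (j + 1) (m + 1)
    (by omega) (by omega)
  rw [Fbar_top m f hs] at a2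
  linarith

lemma Tthr_gap (m : ℕ) (f : ℕ → ℝ) (ε : ℝ) (he : 0 < ε)
    (hf : ∀ j, 1 ≤ j → j ≤ m → 2 * ε ≤ f j) (i j : ℕ)
    (h1 : 1 ≤ i) (hij : i < j) (hj : j ≤ m) : Tthr f i + 2 * ε ≤ Tthr f j := by
  have a1 := Tthr_add_le m f ε he hf i h1 (by omega)
  have a2 := Fbar_mono m f (fun j h1 h2 => by linarith [hf j h1 h2]) (i + 1) j
    (by omega) (by omega)
  rw [Tthr_eq f j (by omega)]
  linarith [hf j (by omega) hj]

lemma jBR_eq (m : ℕ) (f : ℕ → ℝ) (x : ℝ) (J : ℕ) (h1 : 1 ≤ J) (hJ : J ≤ m)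
    (hx : Tthr f J ≤ x) (hx' : ∀ j, J < j → j ≤ m → x < Tthr f j) : jBR m f x = J := by
  unfold jBR
  apply le_antisymm
  · apply Finset.sup_le
    intro j hj
    simp only [Finset.mem_filter, Finset.mem_Icc] at hj
    by_contra hlt
    simp only [id, not_le] at hlt
    exact absurd hj.2 (not_le.2 (hx' j hlt hj.1.2))
  · apply Finset.le_sup (f := id) (b := J)
    simp [h1, hJ, hx]

lemma minf_le (m : ℕ) (f : ℕ → ℝ) (hf : ∀ j, 1 ≤ j → j ≤ m → 0 < f j) (j : ℕ)
    (h1 : 1 ≤ j) (hj : j ≤ m) : minf m f ≤ f j := by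
  unfold minf
  apply csInf_le
  · refine ⟨0, ?_⟩
    rintro x ⟨j, h1, h2, rfl⟩
    exact (hf j h1 h2).le
  · exact ⟨j, h1, hj, rfl⟩

/-! ### The auxiliary Markov chain -/

/-- The state `(κ, J, θ)`: budget, entered orbit (0 if none) and time, frozen at exit. -/
def outS (f : ℕ → ℝ) (δ : ℝ) (n : ℕ) (s : ℕ × ℕ × ℕ) : Prop :=
  1 ≤ s.2.1 ∧ δ < |(s.1 : ℝ) / ((n : ℝ) - s.2.2) - Tthr f s.2.1|

def enterJ (m : ℕ) (f : ℕ → ℝ) (δ : ℝ) (n t κ : ℕ) : ℕ :=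
  sInf {j : ℕ | j ∈ Icc 1 m ∧ |(κ : ℝ) / ((n : ℝ) - t) - Tthr f j| ≤ δ / 2}

def selK (m : ℕ) (a f : ℕ → ℝ) (n κ θ : ℕ) (x : ℝ) : ℕ :=
  κ - (if 0 < κ ∧ (jBR m f ((κ : ℝ) / ((n : ℝ) - θ)) = m ∨
            a (jBR m f ((κ : ℝ) / ((n : ℝ) - θ)) + 1) < x)
        then 1 else 0)

def nextS (m : ℕ) (f : ℕ → ℝ) (δ : ℝ) (n : ℕ) (s : ℕ × ℕ × ℕ) (κ : ℕ) : ℕ × ℕ × ℕ :=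
  (κ, if s.2.1 = 0 then enterJ m f δ n (s.2.2 + 1) κ else s.2.1, s.2.2 + 1)

open Classical in
def stepS (m : ℕ) (a f : ℕ → ℝ) (δ : ℝ) (n : ℕ) (s : ℕ × ℕ × ℕ) (x : ℝ) : ℕ × ℕ × ℕ :=
  if outS f δ n s then s else nextS m f δ n s (selK m a f n s.1 s.2.2 x)

def chainS (m : ℕ) (a f : ℕ → ℝ) (δ : ℝ) (X : ℕ → Ω → ℝ) (n k : ℕ) : ℕ → Ω → ℕ × ℕ × ℕ
  | 0, _ => (k, enterJ m f δ n 0 k, 0)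
  | t + 1, ω => stepS m a f δ n (chainS m a f δ X n k t ω) (X t ω)

lemma enterJ_spec (m : ℕ) (f : ℕ → ℝ) (δ : ℝ) (n t κ : ℕ) (h : enterJ m f δ n t κ ≠ 0) :
    (1 ≤ enterJ m f δ n t κ ∧ enterJ m f δ n t κ ≤ m) ∧
      |(κ : ℝ) / ((n : ℝ) - t) - Tthr f (enterJ m f δ n t κ)| ≤ δ / 2 := by
  have hne : {j : ℕ | j ∈ Icc 1 m ∧ |(κ : ℝ) / ((n : ℝ) - t) - Tthr f j| ≤ δ / 2}.Nonempty := by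
    rw [Set.nonempty_iff_ne_empty]
    intro h0
    apply h
    unfold enterJ
    rw [h0]; simp
  have := Nat.sInf_mem hne
  exact ⟨Finset.mem_Icc.1 this.1, this.2⟩

lemma enterJ_le (m : ℕ) (f : ℕ → ℝ) (δ : ℝ) (n t κ : ℕ) : enterJ m f δ n t κ ≤ m := by
  by_cases h : enterJ m f δ n t κ = 0
  · omega
  · exact (enterJ_spec m f δ n t κ h).1.2

section path
variable (m : ℕ) (a f : ℕ → ℝ) (δ : ℝ) (X : ℕ → Ω → ℝ) (n k : ℕ) (ω : Ω)

lemma chain_J_le (t : ℕ) : (chainS m a f δ X n k t ω).2.1 ≤ m := by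
  induction t with
  | zero => exact enterJ_le _ _ _ _ _ _
  | succ t ih =>
    simp only [chainS, stepS]
    split_ifs
    · exact ih
    · simp only [nextS]
      split_ifs
      · exact enterJ_le _ _ _ _ _ _
      · exact ih

lemma chain_time_le (t : ℕ) : (chainS m a f δ X n k t ω).2.2 ≤ t := by
  induction t with
  | zero => simp [chainS]
  | succ t ih =>
    simp only [chainS, stepS]
    split_ifs
    · omega
    · simp only [nextS]
      omega

lemma chain_frozen (s t : ℕ) (hst : s ≤ t) (h : outS f δ n (chainS m a f δ X n k s ω)) :
    chainS m a f δ X n k t ω = chainS m a f δ X n k s ω := by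
  induction t, hst using Nat.le_induction with
  | base => rfl
  | succ t hst ih =>
    rw [chainS, ih, stepS, if_pos h]

lemma chain_follow (t : ℕ) (h : ∀ s < t, ¬ outS f δ n (chainS m a f δ X n k s ω)) :
    (chainS m a f δ X n k t ω).1 = Kbr m a f X n k t ω ∧ (chainS m a f δ X n k t ω).2.2 = t := by
  induction t with
  | zero => simp [chainS, Kbr]
  | succ t ih =>
    obtain ⟨h1, h2⟩ := ih (fun s hs => h s (by omega))
    rw [chainS, stepS, if_neg (h t (by omega))]
    simp only [nextS, h2, h1, and_true]
    rfl

lemma chain_J_enter (t : ℕ) (h : ∀ s < t, ¬ outS f δ n (chainS m a f δ X n k s ω))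
    (he : ∀ s < t, enterJ m f δ n s (Kbr m a f X n k s ω) = 0) :
    (chainS m a f δ X n k t ω).2.1 = enterJ m f δ n t (Kbr m a f X n k t ω) := by
  induction t with
  | zero => simp [chainS, Kbr]
  | succ t ih =>
    have ih := ih (fun s hs => h s (by omega)) (fun s hs => he s (by omega))
    rw [he t (by omega)] at ih
    obtain ⟨h1, h2⟩ := chain_follow m a f δ X n k ω (t + 1) h
    obtain ⟨h3, h4⟩ := chain_follow m a f δ X n k ω t (fun s hs => h s (by omega))
    rw [← h1]
    rw [chainS, stepS, if_neg (h t (by omega))]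
    simp only [nextS, ih, if_true, h4]

lemma chain_J_keep (s t : ℕ) (hst : s ≤ t) (h0 : (chainS m a f δ X n k s ω).2.1 ≠ 0) :
    (chainS m a f δ X n k t ω).2.1 = (chainS m a f δ X n k s ω).2.1 := by
  induction t, hst using Nat.le_induction with
  | base => rfl
  | succ t hst ih =>
    rw [chainS, stepS]
    split_ifs
    · exact ih
    · simp only [nextS]
      rw [if_neg (by rw [ih]; exact h0), ih]

/-- Pathwise comparison. -/
lemma chain_le_tau (L : ℕ) (hL : L = ⌈(n : ℝ) - 2 / δ - 1⌉₊) :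
    (chainS m a f δ X n k L ω).2.2 ≤ tauBR m f δ (Kbr m a f X n k) n ω := by
  by_contra hlt
  push Not at hlt
  have hLle := chain_time_le m a f δ X n k ω L
  set K := Kbr m a f X n k with hK
  set τ := tauBR m f δ K n ω with hτ
  have hceil : ∀ t : ℕ, t < L → ¬ ((n : ℝ) - 2 / δ - 1 ≤ (t : ℝ)) := by
    intro t ht h
    rw [← Nat.ceil_le, ← hL] at h
    omega
  have hLmem : (n : ℝ) - 2 / δ - 1 ≤ (L : ℝ) := by rw [hL]; exact Nat.le_ceil _
  have hne : {t : ℕ | tau0 m f δ K n ω < t ∧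
    ((n : ℝ) - 2 / δ - 1 ≤ (t : ℝ) ∨
      (jTau0 m f δ K n ω ≤ m ∧ δ < |ratio K n t ω - Tthr f (jTau0 m f δ K n ω)|))}.Nonempty := by
    refine ⟨max (tau0 m f δ K n ω + 1) L, ?_, Or.inl ?_⟩
    · exact lt_of_lt_of_le (Nat.lt_succ_self _) (le_max_left _ _)
    · exact hLmem.trans (by exact_mod_cast le_max_right _ _)
  have hmem := Nat.sInf_mem hne
  change tau0 m f δ K n ω < τ ∧ ((n : ℝ) - 2 / δ - 1 ≤ (τ : ℝ) ∨
      (jTau0 m f δ K n ω ≤ m ∧ δ < |ratio K n τ ω - Tthr f (jTau0 m f δ K n ω)|)) at hmem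
  obtain ⟨h0, h1 | ⟨hj, hd⟩⟩ := hmem
  · exact hceil τ (by omega) h1
  set τ₀ := tau0 m f δ K n ω with hτ₀
  have hτ₀L : τ₀ < L := by omega
  have hnout : ∀ s ≤ τ, ¬ outS f δ n (chainS m a f δ X n k s ω) := by
    intro s hs ho
    have := chain_frozen m a f δ X n k ω s L (by omega) ho
    rw [this] at hlt
    have := chain_time_le m a f δ X n k ω s
    omega
  have hent : ∀ s < τ₀, enterJ m f δ n s (K s ω) = 0 := by
    intro s hs
    by_contra hne
    have := enterJ_spec m f δ n s (K s ω) hne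
    have hle : τ₀ ≤ s := by
      rw [hτ₀]
      apply Nat.sInf_le
      exact Or.inl ⟨enterJ m f δ n s (K s ω), Finset.mem_Icc.2 this.1, this.2⟩
    omega
  have hJ := chain_J_enter m a f δ X n k ω τ₀ (fun s hs => hnout s (by omega)) hent
  have hjt : jTau0 m f δ K n ω = enterJ m f δ n τ₀ (K τ₀ ω) := by
    unfold jTau0
    rw [if_pos (not_le.1 (hceil τ₀ hτ₀L))]
    rfl
  have hpos : enterJ m f δ n τ₀ (K τ₀ ω) ≠ 0 := by
    have hne0 : {t : ℕ | (∃ j ∈ Icc 1 m, |ratio K n t ω - Tthr f j| ≤ δ / 2) ∨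
        (n : ℝ) - 2 / δ - 1 ≤ (t : ℝ)}.Nonempty := ⟨L, Or.inr hLmem⟩
    have hm0 := Nat.sInf_mem hne0
    change (∃ j ∈ Icc 1 m, |ratio K n τ₀ ω - Tthr f j| ≤ δ / 2) ∨
        (n : ℝ) - 2 / δ - 1 ≤ (τ₀ : ℝ) at hm0
    rcases hm0 with ⟨j, hj1, hj2⟩ | h
    · have hm1 := Nat.sInf_mem (s := {j : ℕ | j ∈ Icc 1 m ∧
        |((K τ₀ ω : ℕ) : ℝ) / ((n : ℝ) - τ₀) - Tthr f j| ≤ δ / 2}) ⟨j, hj1, hj2⟩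
      have hm2 := (Finset.mem_Icc.1 hm1.1).1
      intro h
      unfold enterJ at h
      omega
    · exact absurd h (hceil τ₀ hτ₀L)
  have hJ2 := chain_J_keep m a f δ X n k ω τ₀ τ h0.le (by rw [hJ]; exact hpos)
  obtain ⟨c1, c2⟩ := chain_follow m a f δ X n k ω τ (fun s hs => hnout s hs.le)
  apply hnout τ le_rfl
  unfold outS
  rw [hJ2, hJ, c1, c2, ← hK, ← hjt]
  exact ⟨by rw [hjt]; omega, hd⟩

end path

/-! ### One-step estimates -/

lemma up_est (lam d ε T p : ℝ) (hl0 : 0 < lam) (hl1 : lam ≤ 1) (hp0 : 0 ≤ p) (hp1 : p ≤ 1)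
    (hT : T + ε ≤ p) (hd : lam + d ≤ ε) :
    Real.exp (lam * (T + d)) * (p * Real.exp (-lam) + (1 - p)) ≤ 1 := by
  have h1 : Real.exp (-lam) ≤ 1 - lam + lam ^ 2 := by
    have := Real.abs_exp_sub_one_sub_id_le (x := -lam) (by rw [abs_neg, abs_of_pos hl0]; exact hl1)
    have := (abs_le.1 this).2
    nlinarith
  have h2 : p * Real.exp (-lam) + (1 - p) ≤ Real.exp (p * (-lam + lam ^ 2)) := by
    have := Real.add_one_le_exp (p * (-lam + lam ^ 2))
    nlinarith
  calc _ ≤ Real.exp (lam * (T + d)) * Real.exp (p * (-lam + lam ^ 2)) := by gcongr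
    _ = Real.exp (lam * (T + d - p + p * lam)) := by rw [← Real.exp_add]; ring_nf
    _ ≤ 1 := by
      rw [Real.exp_le_one_iff]
      apply mul_nonpos_of_nonneg_of_nonpos hl0.le
      nlinarith

lemma dn_est (lam d ε T q : ℝ) (hl0 : 0 < lam) (hl1 : lam ≤ 1) (hp0 : 0 ≤ q) (hp1 : q ≤ 1)
    (hT : q + ε ≤ T) (hd : lam + d ≤ ε) :
    Real.exp (lam * (d - T)) * (q * Real.exp lam + (1 - q)) ≤ 1 := by
  have h1 : Real.exp lam ≤ 1 + lam + lam ^ 2 := by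
    have := Real.abs_exp_sub_one_sub_id_le (x := lam) (by rw [abs_of_pos hl0]; exact hl1)
    have := (abs_le.1 this).2
    nlinarith
  have h2 : q * Real.exp lam + (1 - q) ≤ Real.exp (q * (lam + lam ^ 2)) := by
    have := Real.add_one_le_exp (q * (lam + lam ^ 2))
    nlinarith
  calc _ ≤ Real.exp (lam * (d - T)) * Real.exp (q * (lam + lam ^ 2)) := by gcongr
    _ = Real.exp (lam * (d - T + q + q * lam)) := by rw [← Real.exp_add]; ring_nf
    _ ≤ 1 := by
      rw [Real.exp_le_one_iff]
      apply mul_nonpos_of_nonneg_of_nonpos hl0.le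
      nlinarith

lemma lintegral_two (ν : Measure ℝ) [IsProbabilityMeasure ν] (P : Set ℝ) (hP : MeasurableSet P)
    (g : ℝ → ℝ) (A B : ℝ) (hA : 0 ≤ A) (hB : 0 ≤ B) (h1 : ∀ x ∈ P, g x = A)
    (h2 : ∀ x, x ∉ P → g x = B) :
    ∫⁻ x, ENNReal.ofReal (g x) ∂ν = ENNReal.ofReal (ν.real P * A + (1 - ν.real P) * B) := by
  rw [← lintegral_add_compl _ hP]
  rw [setLIntegral_congr_fun hP (g := fun _ => ENNReal.ofReal A) (fun x hx => by simp only [h1 x hx]),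
    setLIntegral_congr_fun hP.compl (g := fun _ => ENNReal.ofReal B)
      (fun x hx => by simp only [h2 x hx])]
  have hp1 : ν.real P ≤ 1 := measureReal_le_one
  rw [setLIntegral_const, setLIntegral_const, ← ofReal_measureReal, ← ofReal_measureReal,
    probReal_compl_eq_one_sub hP, ← ENNReal.ofReal_mul hA, ← ENNReal.ofReal_mul hB,
    ← ENNReal.ofReal_add (by positivity) (mul_nonneg hB (by linarith))]
  ring_nf

lemma anti_of (m : ℕ) (a : ℕ → ℝ) (ha : ∀ j, 1 ≤ j → j < m → a (j + 1) < a j) (i j : ℕ)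
    (hi : 1 ≤ i) (hij : i < j) (hj : j ≤ m) : a j < a i := by
  induction j, hij using Nat.le_induction with
  | base => exact ha i hi (by omega)
  | succ j hij ih => exact (ha j (by omega) (by omega)).trans (ih (by omega))

lemma sum_le_real (ν : Measure ℝ) [IsProbabilityMeasure ν] (m : ℕ) (a f : ℕ → ℝ)
    (ha : ∀ j, 1 ≤ j → j < m → a (j + 1) < a j)
    (hf : ∀ j, 1 ≤ j → j ≤ m → 0 < f j)
    (hν : ∀ j, 1 ≤ j → j ≤ m → ν {a j} = ENNReal.ofReal (f j))
    (A : Finset ℕ) (hA : A ⊆ Icc 1 m) (P : Set ℝ) (hP : ∀ j ∈ A, a j ∈ P) :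
    ∑ j ∈ A, f j ≤ ν.real P := by
  have h1 : ν.real (⋃ j ∈ A, {a j}) = ∑ j ∈ A, ν.real {a j} := by
    apply measureReal_biUnion_finset
    · intro i hi j hj hij
      have hi' := Finset.mem_Icc.1 (hA hi)
      have hj' := Finset.mem_Icc.1 (hA hj)
      simp only [Function.onFun, Set.disjoint_singleton]
      rcases lt_or_gt_of_ne hij with h | h
      · exact (anti_of m a ha i j hi'.1 h hj'.2).ne'
      · exact (anti_of m a ha j i hj'.1 h hi'.2).ne
    · intro i _; exact measurableSet_singleton _
    · intro i _; exact measure_ne_top _ _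
  have h2 : ∑ j ∈ A, ν.real {a j} = ∑ j ∈ A, f j := by
    apply Finset.sum_congr rfl
    intro j hj
    have hj' := Finset.mem_Icc.1 (hA hj)
    rw [Measure.real, hν j hj'.1 hj'.2, ENNReal.toReal_ofReal (hf j hj'.1 hj'.2).le]
  rw [← h2, ← h1]
  apply measureReal_mono
  · intro x hx
    simp only [Set.mem_iUnion, Set.mem_singleton_iff] at hx
    obtain ⟨j, hj, rfl⟩ := hx
    exact hP j hj
  · exact measure_ne_top _ _

/-- The exponential Lyapunov function. -/
def Psi (f : ℕ → ℝ) (lam d : ℝ) (n : ℕ) (s : ℕ × ℕ × ℕ) : ℝ :=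
  if s.2.1 = 0 then 1 else
    Real.exp (lam * (|(s.1 : ℝ) - Tthr f s.2.1 * ((n : ℝ) - s.2.2)| - d * ((n : ℝ) - s.2.2)))

def Ccst (lam d : ℝ) : ℝ := Real.exp (2 * lam) / (1 - Real.exp (-(lam * d)))

def Phi (f : ℕ → ℝ) (lam d : ℝ) (n : ℕ) (s : ℕ × ℕ × ℕ) : ℝ :=
  Psi f lam d n s + Ccst lam d * (1 - Real.exp (-(lam * d) * ((n : ℝ) - s.2.2)))

lemma Psi_nonneg (f : ℕ → ℝ) (lam d : ℝ) (n : ℕ) (s : ℕ × ℕ × ℕ) : 0 ≤ Psi f lam d n s := by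
  unfold Psi
  split_ifs <;> positivity

lemma Ccst_pos (lam d : ℝ) (h : 0 < lam * d) : 0 < Ccst lam d := by
  unfold Ccst
  have : Real.exp (-(lam * d)) < 1 := by rw [Real.exp_lt_one_iff]; linarith
  apply div_pos (Real.exp_pos _); linarith

lemma Phi_bounds (f : ℕ → ℝ) (lam d : ℝ) (h : 0 < lam * d) (n : ℕ) (s : ℕ × ℕ × ℕ)
    (hs : s.2.2 ≤ n) : Psi f lam d n s ≤ Phi f lam d n s ∧
      Phi f lam d n s ≤ Psi f lam d n s + Ccst lam d := by
  have hC := Ccst_pos lam d h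
  have hs' : (s.2.2 : ℝ) ≤ n := by exact_mod_cast hs
  have h1 : Real.exp (-(lam * d) * ((n : ℝ) - s.2.2)) ≤ 1 := by
    rw [Real.exp_le_one_iff]
    nlinarith
  have h2 := Real.exp_pos (-(lam * d) * ((n : ℝ) - s.2.2))
  unfold Phi
  constructor <;> nlinarith

/-- The compensator decreases in time by at least `exp (2 lam - lam d (N-1))`. -/
lemma comp_step (lam d N : ℝ) (h : 0 < lam * d) :
    Ccst lam d * (1 - Real.exp (-(lam * d) * (N - 1))) + Real.exp (2 * lam - lam * d * (N - 1))
      = Ccst lam d * (1 - Real.exp (-(lam * d) * N)) := by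
  have hq : Real.exp (-(lam * d)) < 1 := by rw [Real.exp_lt_one_iff]; linarith
  have e1 : Real.exp (-(lam * d) * N) = Real.exp (-(lam * d) * (N - 1)) * Real.exp (-(lam * d)) := by
    rw [← Real.exp_add]; ring_nf
  have e2 : Real.exp (2 * lam - lam * d * (N - 1)) =
      Real.exp (2 * lam) * Real.exp (-(lam * d) * (N - 1)) := by
    rw [← Real.exp_add]; ring_nf
  rw [e1, e2]
  unfold Ccst
  have : 1 - Real.exp (-(lam * d)) ≠ 0 := by linarith
  field_simp
  ring

lemma selK_cases (m : ℕ) (a f : ℕ → ℝ) (n κ θ : ℕ) (x : ℝ) :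
    (selK m a f n κ θ x : ℝ) = κ ∨ (selK m a f n κ θ x : ℝ) = κ - 1 := by
  unfold selK
  split_ifs with h
  · right; rw [Nat.cast_sub (by omega)]; simp
  · left; simp

lemma step_est (ν : Measure ℝ) [IsProbabilityMeasure ν] (m : ℕ) (a f : ℕ → ℝ)
    (ha : ∀ j, 1 ≤ j → j < m → a (j + 1) < a j)
    (ε δ lam d : ℝ) (hδ : 0 < δ) (hδε : δ < ε) (hl0 : 0 < lam) (hl1 : lam ≤ 1) (hd0 : 0 < d)
    (hdδ : δ / 2 ≤ d) (hd : lam + d ≤ ε)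
    (hf : ∀ j, 1 ≤ j → j ≤ m → 2 * ε ≤ f j)
    (hsum : ∑ j ∈ Icc 1 m, f j = 1)
    (hν : ∀ j, 1 ≤ j → j ≤ m → ν {a j} = ENNReal.ofReal (f j))
    (n : ℕ) (s : ℕ × ℕ × ℕ) (hJ : s.2.1 ≤ m) (hθ : s.2.2 + 1 < n) :
    ∫⁻ x, ENNReal.ofReal (Phi f lam d n (stepS m a f δ n s x)) ∂ν
      ≤ ENNReal.ofReal (Phi f lam d n s) := by
  have hpt : (∀ x, Phi f lam d n (stepS m a f δ n s x) ≤ Phi f lam d n s) →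
      ∫⁻ x, ENNReal.ofReal (Phi f lam d n (stepS m a f δ n s x)) ∂ν
      ≤ ENNReal.ofReal (Phi f lam d n s) := by
    intro h
    calc _ ≤ ∫⁻ _, ENNReal.ofReal (Phi f lam d n s) ∂ν :=
          lintegral_mono fun x => ENNReal.ofReal_le_ofReal (h x)
      _ = _ := by simp
  by_cases hout : outS f δ n s
  · apply hpt
    intro x
    rw [stepS, if_pos hout]
  obtain ⟨κ, J, θ⟩ := s
  simp only at hJ hθ
  have hld : 0 < lam * d := by positivity
  have hC := Ccst_pos lam d hld
  have hstep : ∀ x, stepS m a f δ n (κ, J, θ) x =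
      (selK m a f n κ θ x, if J = 0 then enterJ m f δ n (θ + 1) (selK m a f n κ θ x) else J,
        θ + 1) := by
    intro x; rw [stepS, if_neg hout]; rfl
  have hθ' : (θ : ℝ) + 1 < n := by exact_mod_cast hθ
  obtain ⟨N, hN⟩ : ∃ N : ℝ, N = (n : ℝ) - θ := ⟨_, rfl⟩
  have hN1 : (n : ℝ) - ((θ + 1 : ℕ) : ℝ) = N - 1 := by rw [hN]; push_cast; ring
  have hNgt : 1 < N := by rw [hN]; linarith
  have hcs := comp_step lam d N hld
  have hcs0 := Real.exp_pos (2 * lam - lam * d * (N - 1))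
  simp only [Phi, hstep, hN1, ← hN]
  simp only [Phi, hstep, hN1, ← hN] at hpt
  by_cases hJ0 : J = 0
  · subst hJ0
    apply hpt
    intro x
    have hle : Psi f lam d n (selK m a f n κ θ x,
        if 0 = 0 then enterJ m f δ n (θ + 1) (selK m a f n κ θ x) else 0, θ + 1) ≤ 1 := by
      simp only [if_true, Psi, hN1]
      split_ifs with h
      · exact le_rfl
      · obtain ⟨_, h2⟩ := enterJ_spec m f δ n (θ + 1) _ h
        rw [hN1] at h2
        rw [Real.exp_le_one_iff]
        apply mul_nonpos_of_nonneg_of_nonpos hl0.le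
        set T := Tthr f (enterJ m f δ n (θ + 1) (selK m a f n κ θ x))
        set y := (selK m a f n κ θ x : ℝ)
        have hN0 : 0 < N - 1 := by linarith
        have e : y - T * (N - 1) = (y / (N - 1) - T) * (N - 1) := by
          field_simp
        rw [e, abs_mul, abs_of_pos hN0]
        nlinarith
    have h1 : Psi f lam d n (κ, 0, θ) = 1 := by simp [Psi]
    rw [h1]
    linarith
  have hJ1 : 1 ≤ J := by omega
  have hfpos : ∀ j, 1 ≤ j → j ≤ m → 0 < f j := fun j h1 h2 => by linarith [hf j h1 h2]
  have he : 0 < ε := by linarith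
  have hT0 := Tthr_nonneg m f hfpos J hJ1 hJ
  have hT1 := Tthr_le_one m f ε he hf hsum J hJ1 hJ
  have hR : |(κ : ℝ) / N - Tthr f J| ≤ δ := by
    by_contra h
    apply hout
    refine ⟨hJ1, ?_⟩
    simp only [← hN]
    exact not_le.1 h
  obtain ⟨T, hT⟩ : ∃ T, T = Tthr f J := ⟨_, rfl⟩
  simp only [Psi, hJ0, if_false, hN1, ← hN, ← hT]
  simp only [Psi, hJ0, if_false, hN1, ← hN, ← hT] at hpt
  rw [← hT] at hR hT0 hT1
  have hN0 : 0 < N := by linarith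
  obtain ⟨Y, hY⟩ : ∃ Y, Y = (κ : ℝ) - T * N := ⟨_, rfl⟩
  have hRY : (κ : ℝ) / N - T = Y / N := by rw [hY]; field_simp
  have hκ : (κ : ℝ) / N = T + Y / N := by linarith
  rw [← hY]
  rw [← hY] at hpt
  have hnew : ∀ z : ℝ, z - T * (N - 1) = Y + T - (κ - z) := by intro z; rw [hY]; ring
  simp only [hnew] at hpt ⊢
  by_cases hsmall : |Y| ≤ 1
  · apply hpt
    intro x
    have h1 : Real.exp (lam * (|Y + T - ((κ : ℝ) - (selK m a f n κ θ x : ℝ))| - d * (N - 1)))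
        ≤ Real.exp (2 * lam - lam * d * (N - 1)) := by
      apply Real.exp_le_exp.2
      have : |Y + T - ((κ : ℝ) - (selK m a f n κ θ x : ℝ))| ≤ 2 := by
        rw [abs_le] at hsmall ⊢
        rcases selK_cases m a f n κ θ x with h | h <;> rw [h] <;> constructor <;> linarith [hsmall.1, hsmall.2]
      nlinarith
    have := Real.exp_pos (lam * (|Y| - d * N))
    linarith
  -- the probabilistic part
  set P : Set ℝ := {x | 0 < κ ∧ (jBR m f ((κ : ℝ) / N) = m ∨ a (jBR m f ((κ : ℝ) / N) + 1) < x)}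
    with hP
  have hPm : MeasurableSet P := by
    by_cases h1 : 0 < κ ∧ jBR m f ((κ : ℝ) / N) = m
    · have : P = Set.univ := by ext x; simp [hP, h1]
      rw [this]; exact MeasurableSet.univ
    · by_cases h2 : 0 < κ
      · have : P = Set.Ioi (a (jBR m f ((κ : ℝ) / N) + 1)) := by
          ext x
          simp only [hP, Set.mem_ofPred_eq, Set.mem_Ioi]
          tauto
        rw [this]; exact measurableSet_Ioi
      · have : P = ∅ := by
          ext x
          simp only [hP, Set.mem_ofPred_eq, Set.mem_empty_iff_false]
          tauto
        rw [this]; exact MeasurableSet.empty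
  have hin : ∀ x ∈ P, (κ : ℝ) - (selK m a f n κ θ x : ℝ) = 1 := by
    intro x hx
    rw [hP, Set.mem_ofPred_eq] at hx
    rw [selK, ← hN, if_pos hx, Nat.cast_sub hx.1]; simp
  have hnotin : ∀ x, x ∉ P → (κ : ℝ) - (selK m a f n κ θ x : ℝ) = 0 := by
    intro x hx
    rw [hP, Set.mem_ofPred_eq] at hx
    rw [selK, ← hN, if_neg hx]; simp
  set D := Ccst lam d * (1 - Real.exp (-(lam * d) * (N - 1))) with hD
  have hD0 : 0 ≤ D := by
    apply mul_nonneg hC.le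
    have : Real.exp (-(lam * d) * (N - 1)) ≤ 1 := by
      rw [Real.exp_le_one_iff]; nlinarith
    linarith
  rw [lintegral_two ν P hPm _ (Real.exp (lam * (|Y + T - 1| - d * (N - 1))) + D)
    (Real.exp (lam * (|Y + T - 0| - d * (N - 1))) + D) (by positivity) (by positivity)
    (fun x hx => by rw [hin x hx]) (fun x hx => by rw [hnotin x hx])]
  apply ENNReal.ofReal_le_ofReal
  have hp0 : 0 ≤ ν.real P := measureReal_nonneg
  have hp1 : ν.real P ≤ 1 := measureReal_le_one
  suffices hmain : ν.real P * Real.exp (lam * (|Y + T - 1| - d * (N - 1))) +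
      (1 - ν.real P) * Real.exp (lam * (|Y + T - 0| - d * (N - 1))) ≤
      Real.exp (lam * (|Y| - d * N)) by
    rw [← hcs]; linarith
  rw [hRY, abs_le] at hR
  rcases lt_abs.1 (not_le.1 hsmall) with hY1 | hY1
  · -- above the threshold
    have hYN : 0 < Y / N := by positivity
    have hj : jBR m f ((κ : ℝ) / N) = J := by
      apply jBR_eq m f _ J hJ1 hJ
      · rw [← hT]; linarith
      · intro j h1 h2
        have := Tthr_gap m f ε he hf J j hJ1 h1 h2
        linarith [hR.2]
    have hκ0 : 0 < κ := by
      have : 0 < (κ : ℝ) := by nlinarith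
      exact_mod_cast this
    have hprob : Fbar f (J + 1) ≤ ν.real P := by
      unfold Fbar
      apply sum_le_real ν m a f ha hfpos hν
      · apply Finset.Icc_subset_Icc le_rfl; omega
      · intro i hi
        rw [Finset.mem_Icc] at hi
        refine ⟨hκ0, ?_⟩
        rw [hj]
        by_cases h : J = m
        · exact Or.inl h
        · right
          exact anti_of m a ha i (J + 1) hi.1 (by omega) (by omega)
    have hTp : T + ε ≤ ν.real P := by
      have := Tthr_add_le m f ε he hf J hJ1 hJ
      rw [← hT] at this; linarith
    have hest := up_est lam d ε T (ν.real P) hl0 hl1 hp0 hp1 hTp hd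
    rw [abs_of_nonneg (by linarith : 0 ≤ Y + T - 1), abs_of_nonneg (by linarith : 0 ≤ Y + T - 0),
      abs_of_nonneg (by linarith : 0 ≤ Y)]
    have e1 : Real.exp (lam * (Y + T - 1 - d * (N - 1))) =
        Real.exp (lam * (Y - d * N)) * (Real.exp (lam * (T + d)) * Real.exp (-lam)) := by
      rw [← Real.exp_add, ← Real.exp_add]; ring_nf
    have e2 : Real.exp (lam * (Y + T - 0 - d * (N - 1))) =
        Real.exp (lam * (Y - d * N)) * Real.exp (lam * (T + d)) := by
      rw [← Real.exp_add]; ring_nf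
    rw [e1, e2]
    have := mul_le_mul_of_nonneg_left hest (Real.exp_pos (lam * (Y - d * N))).le
    linarith
  · -- below the threshold
    have hJ2 : 2 ≤ J := by
      by_contra h
      obtain rfl : J = 1 := by omega
      rw [Tthr_one] at hT
      have : (0 : ℝ) ≤ κ := by positivity
      rw [hT] at hY
      linarith
    have hYN : Y / N < 0 := div_neg_of_neg_of_pos (by linarith) hN0
    have hj : jBR m f ((κ : ℝ) / N) = J - 1 := by
      apply jBR_eq m f _ (J - 1) (by omega) (by omega)
      · have := Tthr_gap m f ε he hf (J - 1) J (by omega) (by omega) hJ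
        linarith [hR.1]
      · intro j h1 h2
        rcases Nat.lt_or_ge J j with h | h
        · have := Tthr_gap m f ε he hf J j hJ1 h h2
          linarith
        · obtain rfl : j = J := by omega
          linarith
    have hprob : ν.real P ≤ Fbar f J := by
      have h1 : ∑ i ∈ Icc J m, f i ≤ ν.real Pᶜ := by
        apply sum_le_real ν m a f ha hfpos hν
        · exact Finset.Icc_subset_Icc hJ1 le_rfl
        · intro i hi
          rw [Finset.mem_Icc] at hi
          rintro ⟨_, h⟩
          rw [hj, Nat.sub_add_cancel hJ1] at h
          rcases h with h | h
          · omega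
          · rcases Nat.eq_or_lt_of_le hi.1 with h' | h'
            · rw [h'] at h; exact lt_irrefl _ h
            · exact lt_asymm h (anti_of m a ha J i hJ1 h' hi.2)
      rw [probReal_compl_eq_one_sub hPm] at h1
      have h2 : ∑ i ∈ Icc 1 (J - 1), f i + ∑ i ∈ Icc J m, f i = 1 := by
        rw [← hsum, ← Finset.sum_union]
        · congr 1
          ext i; simp only [Finset.mem_union, Finset.mem_Icc]; omega
        · rw [Finset.disjoint_left]
          intro i; simp only [Finset.mem_Icc]; omega
      unfold Fbar
      linarith
    have hTp : ν.real P + ε ≤ T := by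
      rw [hT, Tthr_eq f J hJ2]
      linarith [hf J hJ1 hJ]
    have hest := dn_est lam d ε T (ν.real P) hl0 hl1 hp0 hp1 hTp hd
    rw [abs_of_nonpos (by linarith : Y + T - 1 ≤ 0), abs_of_nonpos (by linarith : Y + T - 0 ≤ 0),
      abs_of_nonpos (by linarith : Y ≤ 0)]
    have e1 : Real.exp (lam * (-(Y + T - 1) - d * (N - 1))) =
        Real.exp (lam * (-Y - d * N)) * (Real.exp (lam * (d - T)) * Real.exp lam) := by
      rw [← Real.exp_add, ← Real.exp_add]; ring_nf
    have e2 : Real.exp (lam * (-(Y + T - 0) - d * (N - 1))) =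
        Real.exp (lam * (-Y - d * N)) * Real.exp (lam * (d - T)) := by
      rw [← Real.exp_add]; ring_nf
    rw [e1, e2]
    have := mul_le_mul_of_nonneg_left hest (Real.exp_pos (lam * (-Y - d * N))).le
    linarith

/-! ### Measurability -/

lemma measurable_selK (m : ℕ) (a f : ℕ → ℝ) (n κ θ : ℕ) : Measurable (selK m a f n κ θ) := by
  have hm : MeasurableSet {x : ℝ | 0 < κ ∧ (jBR m f ((κ : ℝ) / ((n : ℝ) - θ)) = m ∨
            a (jBR m f ((κ : ℝ) / ((n : ℝ) - θ)) + 1) < x)} :=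
    (MeasurableSet.const _).inter ((MeasurableSet.const _).union measurableSet_Ioi)
  have h2 : Measurable fun x : ℝ => (if 0 < κ ∧ (jBR m f ((κ : ℝ) / ((n : ℝ) - θ)) = m ∨
            a (jBR m f ((κ : ℝ) / ((n : ℝ) - θ)) + 1) < x) then 1 else 0 : ℕ) :=
    Measurable.ite hm measurable_const measurable_const
  exact (Measurable.of_discrete (f := fun b : ℕ => κ - b)).comp h2

lemma measurable_stepS (m : ℕ) (a f : ℕ → ℝ) (δ : ℝ) (n : ℕ) :
    Measurable (fun p : (ℕ × ℕ × ℕ) × ℝ => stepS m a f δ n p.1 p.2) := by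
  apply measurable_from_prod_countable_right
  intro s
  by_cases h : outS f δ n s
  · simp only [stepS, if_pos h]
    exact measurable_const
  · simp only [stepS, if_neg h]
    exact (Measurable.of_discrete (f := nextS m f δ n s)).comp (measurable_selK m a f n s.1 s.2.2)

lemma chain_meas (m : ℕ) (a f : ℕ → ℝ) (δ : ℝ) (X : ℕ → Ω → ℝ) (n k : ℕ)
    (m0 : MeasurableSpace Ω) (t : ℕ) (h : ∀ i < t, Measurable (X i)) :
    Measurable (chainS m a f δ X n k t) := by
  induction t with
  | zero => exact measurable_const
  | succ t ih =>
    exact (measurable_stepS m a f δ n).comp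
      ((ih fun i hi => h i (by omega)).prodMk (h t (by omega)))

lemma Kbr_meas (m : ℕ) (a f : ℕ → ℝ) (X : ℕ → Ω → ℝ) (n k : ℕ)
    [MeasurableSpace Ω] (h : ∀ i, Measurable (X i)) (t : ℕ) :
    Measurable (Kbr m a f X n k t) := by
  induction t with
  | zero => exact measurable_const
  | succ t ih =>
    have : Measurable (fun p : ℕ × ℝ => selK m a f n p.1 t p.2) := by
      apply measurable_from_prod_countable_right
      intro κ
      exact measurable_selK m a f n κ t
    exact this.comp (ih.prodMk (h t))

lemma measurable_sInf_nat [MeasurableSpace Ω] (p : ℕ → Ω → Prop)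
    (hp : ∀ t, MeasurableSet {ω | p t ω}) : Measurable fun ω => sInf {t : ℕ | p t ω} := by
  classical
  have key : ∀ ω, sInf {t : ℕ | p t ω} =
      if ∃ t, p t ω then sInf {t : ℕ | p t ω ∨ ∀ s, ¬ p s ω} else 0 := by
    intro ω
    split_ifs with h
    · have : ¬ ∀ s, ¬ p s ω := by push Not; exact h
      simp only [this, or_false]
    · push Not at h
      have : {t : ℕ | p t ω} = ∅ := by ext t; simp [h t]
      rw [this]; simp
  have hex : MeasurableSet {ω | ∃ t, p t ω} := by
    have : {ω | ∃ t, p t ω} = ⋃ t, {ω | p t ω} := by ext; simp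
    rw [this]; exact MeasurableSet.iUnion hp
  have hall : MeasurableSet {ω | ∀ s, ¬ p s ω} := by
    have : {ω | ∀ s, ¬ p s ω} = {ω | ∃ t, p t ω}ᶜ := by ext; simp
    rw [this]; exact hex.compl
  have hq : ∀ ω, ∃ t, (p t ω ∨ ∀ s, ¬ p s ω) := by
    intro ω
    by_cases h : ∃ t, p t ω
    · obtain ⟨t, ht⟩ := h; exact ⟨t, Or.inl ht⟩
    · exact ⟨0, Or.inr (by push Not at h; exact h)⟩
  have hfind : Measurable fun ω => Nat.find (hq ω) :=
    measurable_find hq (fun t => (hp t).union hall)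
  have : (fun ω => sInf {t : ℕ | p t ω}) = fun ω => if ∃ t, p t ω then Nat.find (hq ω) else 0 := by
    funext ω
    rw [key ω]
    congr 1
    have hne : {t : ℕ | p t ω ∨ ∀ s, ¬ p s ω}.Nonempty := hq ω
    apply le_antisymm
    · exact Nat.sInf_le (Nat.find_spec (hq ω))
    · exact Nat.find_min' (hq ω) (Nat.sInf_mem hne)
  rw [this]
  exact Measurable.ite hex hfind measurable_const

section tau
variable [MeasurableSpace Ω] (m : ℕ) (f : ℕ → ℝ) (δ : ℝ) (K : ℕ → Ω → ℕ) (n : ℕ)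

lemma tau0_meas (hK : ∀ t, Measurable (K t)) : Measurable (tau0 m f δ K n) := by
  apply measurable_sInf_nat
  intro t
  have : MeasurableSet (K t ⁻¹' {κ : ℕ | (∃ j ∈ Icc 1 m, |(κ : ℝ) / ((n : ℝ) - t) - Tthr f j| ≤ δ / 2)
      ∨ (n : ℝ) - 2 / δ - 1 ≤ (t : ℝ)}) := hK t (MeasurableSet.of_discrete)
  exact this

lemma jTau0_meas (hK : ∀ t, Measurable (K t)) : Measurable (jTau0 m f δ K n) := by
  have h0 := tau0_meas m f δ K n hK
  have hKt : Measurable fun ω => K (tau0 m f δ K n ω) ω := by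
    have : Measurable (fun p : ℕ × Ω => K p.1 p.2) :=
      measurable_from_prod_countable_right fun t => hK t
    exact this.comp (h0.prodMk measurable_id)
  have hG : Measurable (fun p : ℕ × ℕ => if (p.1 : ℝ) < (n : ℝ) - 2 / δ - 1 then
    sInf {j : ℕ | j ∈ Icc 1 m ∧ |(p.2 : ℝ) / ((n : ℝ) - p.1) - Tthr f j| ≤ δ / 2}
    else m + 1) := Measurable.of_discrete
  exact hG.comp (h0.prodMk hKt)

lemma tau_meas (hK : ∀ t, Measurable (K t)) : Measurable (tauBR m f δ K n) := by
  apply measurable_sInf_nat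
  intro t
  have hG : MeasurableSet {p : ℕ × ℕ × ℕ | p.1 < t ∧
    ((n : ℝ) - 2 / δ - 1 ≤ (t : ℝ) ∨
      (p.2.1 ≤ m ∧ δ < |(p.2.2 : ℝ) / ((n : ℝ) - t) - Tthr f p.2.1|))} := MeasurableSet.of_discrete
  exact ((tau0_meas m f δ K n hK).prodMk ((jTau0_meas m f δ K n hK).prodMk (hK t))) hG

end tau

lemma tau_bdd (m : ℕ) (f : ℕ → ℝ) (δ : ℝ) (K : ℕ → Ω → ℕ) (n : ℕ) (ω : Ω) :
    tauBR m f δ K n ω ≤ ⌈(n : ℝ) - 2 / δ - 1⌉₊ + 1 := by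
  set L := ⌈(n : ℝ) - 2 / δ - 1⌉₊ with hL
  have h0 : tau0 m f δ K n ω ≤ L := by
    apply Nat.sInf_le
    exact Or.inr (Nat.le_ceil _)
  apply Nat.sInf_le
  refine ⟨by omega, Or.inl ?_⟩
  have := Nat.le_ceil ((n : ℝ) - 2 / δ - 1)
  push_cast
  linarith

/-! ### Expectation bound along the chain -/

lemma chain_indep [MeasurableSpace Ω] (μ : Measure Ω) [IsProbabilityMeasure μ]
    (m : ℕ) (a f : ℕ → ℝ) (δ : ℝ) (X : ℕ → Ω → ℝ) (n k : ℕ)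
    (hX : ∀ i, Measurable (X i)) (hI : iIndepFun X μ) (t : ℕ) :
    IndepFun (chainS m a f δ X n k t) (X t) μ := by
  have h := indep_iSup_of_disjoint (m := fun i => MeasurableSpace.comap (X i) inferInstance)
    (fun i => (hX i).comap_le) hI (S := {i | i < t}) (T := {t}) (by simp)
  rw [IndepFun_iff_Indep]
  refine indep_of_indep_of_le_left (indep_of_indep_of_le_right h ?_) ?_
  · exact le_iSup₂_of_le t rfl le_rfl
  · rw [← measurable_iff_comap_le]
    apply chain_meas
    intro i hi
    rw [measurable_iff_comap_le]
    exact le_iSup₂_of_le (f := fun i (_ : i ∈ {i | i < t}) =>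
      MeasurableSpace.comap (X i) inferInstance) i hi le_rfl

lemma chain_expect [MeasurableSpace Ω] (μ : Measure Ω) [IsProbabilityMeasure μ]
    (m : ℕ) (a f : ℕ → ℝ) (X : ℕ → Ω → ℝ) (n k : ℕ)
    (hX : ∀ i, Measurable (X i)) (hI : iIndepFun X μ)
    (ha : ∀ j, 1 ≤ j → j < m → a (j + 1) < a j)
    (ε δ lam d : ℝ) (hδ : 0 < δ) (hδε : δ < ε) (hl0 : 0 < lam) (hl1 : lam ≤ 1) (hd0 : 0 < d)
    (hdδ : δ / 2 ≤ d) (hd : lam + d ≤ ε)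
    (hf : ∀ j, 1 ≤ j → j ≤ m → 2 * ε ≤ f j)
    (hsum : ∑ j ∈ Icc 1 m, f j = 1)
    (hν : ∀ t j, 1 ≤ j → j ≤ m → μ {ω | X t ω = a j} = ENNReal.ofReal (f j))
    (t : ℕ) (ht : t < n) :
    ∫⁻ ω, ENNReal.ofReal (Phi f lam d n (chainS m a f δ X n k t ω)) ∂μ
      ≤ ENNReal.ofReal (1 + Ccst lam d) := by
  induction t with
  | zero =>
    have hpt : ∀ ω, Phi f lam d n (chainS m a f δ X n k 0 ω) ≤ 1 + Ccst lam d := by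
      intro ω
      have h1 := (Phi_bounds f lam d (by positivity) n (chainS m a f δ X n k 0 ω)
        (by simp [chainS])).2
      have h2 : Psi f lam d n (chainS m a f δ X n k 0 ω) ≤ 1 := by
        rw [show chainS m a f δ X n k 0 ω = (k, enterJ m f δ n 0 k, 0) from rfl]
        by_cases h : enterJ m f δ n 0 k = 0
        · rw [Psi, if_pos h]
        · obtain ⟨_, h2⟩ := enterJ_spec m f δ n 0 k h
          rw [Psi, if_neg h]
          simp only
          rw [Real.exp_le_one_iff]
          apply mul_nonpos_of_nonneg_of_nonpos hl0.le
          set T := Tthr f (enterJ m f δ n 0 k)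
          have hN : 0 < (n : ℝ) - ((0 : ℕ) : ℝ) := by
            have : (0 : ℝ) < n := by exact_mod_cast ht
            simpa using this
          set N := (n : ℝ) - ((0 : ℕ) : ℝ)
          have e : (k : ℝ) - T * N = (k / N - T) * N := by field_simp
          rw [e, abs_mul, abs_of_pos hN]
          nlinarith
      linarith
    calc _ ≤ ∫⁻ _, ENNReal.ofReal (1 + Ccst lam d) ∂μ :=
          lintegral_mono fun ω => ENNReal.ofReal_le_ofReal (hpt ω)
      _ = _ := by simp
  | succ t ih =>
    refine le_trans ?_ (ih (by omega))
    have hS := chain_meas m a f δ X n k inferInstance t (fun i _ => hX i)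
    have hind := chain_indep μ m a f δ X n k hX hI t
    rw [indepFun_iff_map_prod_eq_prod_map_map hS.aemeasurable (hX t).aemeasurable] at hind
    have hPhi : Measurable fun s => ENNReal.ofReal (Phi f lam d n s) := Measurable.of_discrete
    have hg : Measurable (fun p : (ℕ × ℕ × ℕ) × ℝ =>
        ENNReal.ofReal (Phi f lam d n (stepS m a f δ n p.1 p.2))) :=
      hPhi.comp (measurable_stepS m a f δ n)
    have : IsProbabilityMeasure (μ.map (X t)) := Measure.isProbabilityMeasure_map (hX t).aemeasurable
    have hlaw : ∀ j, 1 ≤ j → j ≤ m → (μ.map (X t)) {a j} = ENNReal.ofReal (f j) := by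
      intro j h1 h2
      rw [Measure.map_apply (hX t) (measurableSet_singleton _), ← hν t j h1 h2]
      rfl
    calc ∫⁻ ω, ENNReal.ofReal (Phi f lam d n (chainS m a f δ X n k (t + 1) ω)) ∂μ
        = ∫⁻ p, ENNReal.ofReal (Phi f lam d n (stepS m a f δ n p.1 p.2))
            ∂(μ.map (fun ω => (chainS m a f δ X n k t ω, X t ω))) := by
          rw [lintegral_map hg (hS.prodMk (hX t))]; rfl
      _ = ∫⁻ s, ∫⁻ x, ENNReal.ofReal (Phi f lam d n (stepS m a f δ n s x)) ∂(μ.map (X t))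
            ∂(μ.map (chainS m a f δ X n k t)) := by
          rw [hind, lintegral_prod _ hg.aemeasurable]
      _ = ∫⁻ ω, ∫⁻ x, ENNReal.ofReal (Phi f lam d n
            (stepS m a f δ n (chainS m a f δ X n k t ω) x)) ∂(μ.map (X t)) ∂μ := by
          rw [lintegral_map Measurable.of_discrete hS]
      _ ≤ _ := by
          apply lintegral_mono
          intro ω
          apply step_est (μ.map (X t)) m a f ha ε δ lam d hδ hδε hl0 hl1 hd0 hdδ hd hf hsum hlaw
          · exact chain_J_le m a f δ X n k ω t
          · have := chain_time_le m a f δ X n k ω t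
            omega

/-- Pathwise: the remaining time is controlled by the Lyapunov function. -/
lemma remaining_le (m : ℕ) (a f : ℕ → ℝ) (X : ℕ → Ω → ℝ) (n k : ℕ) (ω : Ω)
    (δ lam d : ℝ) (hδ : 0 < δ) (hl0 : 0 < lam) (hd0 : 0 < d) (hdδ : d < δ)
    (L : ℕ) (hL : L = ⌈(n : ℝ) - 2 / δ - 1⌉₊) (hLn : L < n) :
    (n : ℝ) - (chainS m a f δ X n k L ω).2.2 ≤
      (2 / δ + 1) + 1 / (lam * (δ - d)) * Phi f lam d n (chainS m a f δ X n k L ω) := by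
  have hle := chain_time_le m a f δ X n k ω L
  have hc : 0 < lam * (δ - d) := mul_pos hl0 (by linarith)
  have hPP := (Phi_bounds f lam d (by positivity) n (chainS m a f δ X n k L ω) (by omega)).1
  have hP0 := Psi_nonneg f lam d n (chainS m a f δ X n k L ω)
  by_cases hout : outS f δ n (chainS m a f δ X n k L ω)
  · obtain ⟨h1, h2⟩ := hout
    set s := chainS m a f δ X n k L ω
    have hN : 0 < (n : ℝ) - s.2.2 := by
      have : (s.2.2 : ℝ) < n := by exact_mod_cast (by omega : s.2.2 < n)
      linarith
    set N := (n : ℝ) - s.2.2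
    have e : (s.1 : ℝ) - Tthr f s.2.1 * N = (s.1 / N - Tthr f s.2.1) * N := by field_simp
    have hPsi : lam * (δ - d) * N ≤ Psi f lam d n s := by
      rw [Psi, if_neg (by omega)]
      have h3 : lam * (δ - d) * N ≤
          lam * (|(s.1 : ℝ) - Tthr f s.2.1 * N| - d * N) := by
        rw [e, abs_mul, abs_of_pos hN, mul_assoc]
        apply mul_le_mul_of_nonneg_left _ hl0.le
        nlinarith
      have := Real.add_one_le_exp (lam * (|(s.1 : ℝ) - Tthr f s.2.1 * N| - d * N))
      linarith
    have h4 : N ≤ 1 / (lam * (δ - d)) * Phi f lam d n s := by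
      rw [one_div, inv_mul_eq_div, le_div_iff₀ hc]
      linarith
    have : 0 < 2 / δ := by positivity
    linarith
  · have hn : ∀ s < L, ¬ outS f δ n (chainS m a f δ X n k s ω) := by
      intro s hs ho
      apply hout
      rw [chain_frozen m a f δ X n k ω s L hs.le ho]
      exact ho
    rw [(chain_follow m a f δ X n k ω L hn).2]
    have h1 : (n : ℝ) - 2 / δ - 1 ≤ (L : ℝ) := by rw [hL]; exact Nat.le_ceil _
    have h2 : 0 ≤ 1 / (lam * (δ - d)) * Phi f lam d n (chainS m a f δ X n k L ω) := by
      apply mul_nonneg (by positivity); linarith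
    linarith

/-- Theorem 2, the BR stopping time: there is a constant `M ≡ M(ε, δ)`
such that for all `(n,k) ∈ 𝒯` the exit time `τ` of the Budget-Ratio budget-ratio process
from the orbit of the threshold it first enters satisfies `E[τ] ≥ n - M`. -/
theorem budget_ratio_stopping_time (ε δ : ℝ) (hδ0 : 0 < δ) (hδε : δ < ε) :
    ∃ M : ℝ,
      ∀ (Ω : Type) [MeasurableSpace Ω] (μ : Measure Ω)
        (m : ℕ) (a f : ℕ → ℝ) (X U : ℕ → Ω → ℝ),
        Model μ m a f X U → ε = minf m f / 2 →
        ∀ n k : ℕ, k ≤ n →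
          ∀ K : ℕ → Ω → ℕ, K = Kbr m a f X n k →
            (n : ℝ) - M ≤ ∫ ω, (tauBR m f δ K n ω : ℝ) ∂μ := by
  have hd0 : 0 < 3 * δ / 4 := by positivity
  have hl0 : 0 < ε - δ := by linarith
  have hC := Ccst_pos (ε - δ) (3 * δ / 4) (by positivity)
  have hc0 : 0 < 1 / ((ε - δ) * (δ - 3 * δ / 4)) :=
    one_div_pos.2 (mul_pos hl0 (by linarith))
  have h2δ : 0 < 2 / δ := by positivity
  refine ⟨(2 / δ + 1) + 1 / ((ε - δ) * (δ - 3 * δ / 4)) * (1 + Ccst (ε - δ) (3 * δ / 4)), ?_⟩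
  intro Ω _ μ m a f X U hM hε n k hkn K hK
  have := hM.hprob
  have hprod : 0 < 1 / ((ε - δ) * (δ - 3 * δ / 4)) * (1 + Ccst (ε - δ) (3 * δ / 4)) := by
    apply mul_pos hc0; linarith
  by_cases hsmall : (n : ℝ) ≤ 2 / δ + 1
  · have : 0 ≤ ∫ ω, (tauBR m f δ K n ω : ℝ) ∂μ := integral_nonneg fun ω => by positivity
    linarith
  push Not at hsmall
  set lam := ε - δ with hlam
  set d := 3 * δ / 4 with hd
  have hf : ∀ j, 1 ≤ j → j ≤ m → 2 * ε ≤ f j := by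
    intro j h1 h2
    have := minf_le m f hM.hf_pos j h1 h2
    linarith
  have hl1 : lam ≤ 1 := by
    have h1 := hf 1 le_rfl hM.hm
    have h2 : f 1 ≤ ∑ j ∈ Icc 1 m, f j := by
      apply Finset.single_le_sum (f := f)
      · intro i hi
        rw [Finset.mem_Icc] at hi
        exact (hM.hf_pos i hi.1 hi.2).le
      · rw [Finset.mem_Icc]; exact ⟨le_rfl, hM.hm⟩
    rw [hM.hf_sum] at h2
    linarith
  obtain ⟨L, hL⟩ : ∃ L : ℕ, L = ⌈(n : ℝ) - 2 / δ - 1⌉₊ := ⟨_, rfl⟩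
  have hLn : L < n := by
    have h1 : (L : ℝ) < (n : ℝ) - 2 / δ - 1 + 1 := by
      rw [hL]; exact Nat.ceil_lt_add_one (by linarith)
    have : (L : ℝ) < n := by linarith
    exact_mod_cast this
  have hI : iIndepFun X μ := by
    have := hM.hIndep.comp (fun _ => Prod.fst) (fun _ => measurable_fst)
    exact this
  have hexp := chain_expect μ m a f X n k hM.hXmeas hI hM.ha_anti ε δ lam d hδ0 hδε hl0 hl1 hd0
    (by rw [hd]; linarith) (by rw [hlam, hd]; linarith) hf hM.hf_sum hM.hXdist L hLn
  have hS := chain_meas m a f δ X n k inferInstance L (fun i _ => hM.hXmeas i)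
  have hPm : Measurable fun ω => Phi f lam d n (chainS m a f δ X n k L ω) :=
    (Measurable.of_discrete (f := Phi f lam d n)).comp hS
  have hP0 : ∀ ω, 0 ≤ Phi f lam d n (chainS m a f δ X n k L ω) := by
    intro ω
    have h1 := (Phi_bounds f lam d (by positivity) n (chainS m a f δ X n k L ω)
      (by have := chain_time_le m a f δ X n k ω L; omega)).1
    exact (Psi_nonneg f lam d n _).trans h1
  have hPint : Integrable (fun ω => Phi f lam d n (chainS m a f δ X n k L ω)) μ := by
    refine ⟨hPm.aestronglyMeasurable, ?_⟩
    rw [hasFiniteIntegral_iff_ofReal (Filter.Eventually.of_forall hP0)]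
    exact lt_of_le_of_lt hexp ENNReal.ofReal_lt_top
  have hPle : ∫ ω, Phi f lam d n (chainS m a f δ X n k L ω) ∂μ ≤ 1 + Ccst lam d := by
    rw [integral_eq_lintegral_of_nonneg_ae (Filter.Eventually.of_forall hP0)
      hPm.aestronglyMeasurable]
    exact ENNReal.toReal_le_of_le_ofReal (by linarith) hexp
  subst hK
  have hτm : Measurable fun ω => (tauBR m f δ (Kbr m a f X n k) n ω : ℝ) :=
    (Measurable.of_discrete (f := fun i : ℕ => (i : ℝ))).comp
      (tau_meas m f δ _ n (Kbr_meas m a f X n k hM.hXmeas))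
  have hτint : Integrable (fun ω => (tauBR m f δ (Kbr m a f X n k) n ω : ℝ)) μ := by
    refine Integrable.of_bound hτm.aestronglyMeasurable ((L + 1 : ℕ) : ℝ)
      (Filter.Eventually.of_forall fun ω => ?_)
    rw [Real.norm_of_nonneg (by positivity), hL]
    exact_mod_cast tau_bdd m f δ (Kbr m a f X n k) n ω
  have hpath : ∀ ω, (n : ℝ) - (2 / δ + 1) -
      1 / (lam * (δ - d)) * Phi f lam d n (chainS m a f δ X n k L ω) ≤
      (tauBR m f δ (Kbr m a f X n k) n ω : ℝ) := by
    intro ω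
    have h1 := remaining_le m a f X n k ω δ lam d hδ0 hl0 hd0 (by rw [hd]; linarith) L hL hLn
    have h2 : ((chainS m a f δ X n k L ω).2.2 : ℝ) ≤ (tauBR m f δ (Kbr m a f X n k) n ω : ℝ) := by
      exact_mod_cast chain_le_tau m a f δ X n k ω L hL
    linarith
  have hmono := integral_mono ((integrable_const _).sub (hPint.const_mul _)) hτint hpath
  simp only [Pi.sub_apply] at hmono
  rw [integral_sub (integrable_const _) (hPint.const_mul _), integral_const_mul] at hmono
  simp only [integral_const, probReal_univ, one_smul] at hmono
  have h5 := mul_le_mul_of_nonneg_left hPle hc0.le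
  linarith

end MultiSecretary
end
end

section
/- Let τ₁ = min{t ∈ {0, 1, …, n−1} : K_t/(n−t) > 1}, with τ₁ = n−1 if the set is empty. Then the stopped ratio process {R_{t∧τ₁} : 0 ≤ t ≤ n−1}, where R_t = K_t/(n−t), is a martingale with respect to the filtration (𝓕_t). -/
open MeasureTheory ProbabilityTheory Finset

noncomputable section

namespace MultiSecretary

variable {Ω : Type*}

/-- Proposition 3: the Adaptive-Index remaining-budget ratio
`R_t = K_t/(n-t)`, stopped at `τ₁ = min{t ≤ n-1 : R_t > 1}` (`τ₁ = n-1` if no such `t`),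
is a martingale (the finite-horizon process is extended to all of `ℕ` by freezing it at
time `n-1`). -/
theorem adaptive_index_stopped_ratio_martingale {Ω : Type*} [m0 : MeasurableSpace Ω]
    (μ : Measure Ω) [IsProbabilityMeasure μ] (ℱ : Filtration ℕ m0)
    (n k : ℕ) (hn : 1 ≤ n) (hkn : k ≤ n)
    (σp : ℕ → Ω → ℕ) (K : ℕ → Ω → ℕ)
    (hσ01 : ∀ t ω, σp t ω ≤ 1)
    (hσmeas : ∀ t, t < n - 1 → Measurable[ℱ (t + 1)] (σp (t + 1)))
    (hK0 : ∀ ω, K 0 ω = k)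
    (hKrec : ∀ t, t < n - 1 → ∀ ω, K (t + 1) ω = K t ω - σp (t + 1) ω)
    (hcond : ∀ t, t < n - 1 →
      (μ[(fun ω => (σp (t + 1) ω : ℝ)) | ℱ t]) =ᵐ[μ]
        fun ω => min ((K t ω : ℝ) / ((n : ℝ) - (t : ℝ))) 1)
    (τ₁ : Ω → ℕ)
    (hτ₁ : ∀ ω, τ₁ ω =
      sInf {t : ℕ | t = n - 1 ∨ (t ≤ n - 1 ∧ 1 < (K t ω : ℝ) / ((n : ℝ) - (t : ℝ)))}) :
    Martingale
      (fun t ω =>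
        (K (min (min t (n - 1)) (τ₁ ω)) ω : ℝ) /
          ((n : ℝ) - (min (min t (n - 1)) (τ₁ ω) : ℕ)))
      ℱ μ := by
  classical
  -- positivity of denominators
  have hden : ∀ t, t ≤ n - 1 → (1 : ℝ) ≤ (n : ℝ) - (t : ℝ) := by
    intro t ht
    have h : t + 1 ≤ n := by omega
    have h' : (t : ℝ) + 1 ≤ n := by exact_mod_cast h
    linarith
  -- the budget is adapted and bounded
  have hKmeas : ∀ t, t ≤ n - 1 → Measurable[ℱ t] (K t) := by
    intro t
    induction t with
    | zero =>
      intro _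
      have : K 0 = fun _ => k := funext hK0
      rw [this]
      exact measurable_const
    | succ t ih =>
      intro ht
      have h1 : Measurable[ℱ (t + 1)] (K t) := (ih (by omega)).mono (ℱ.mono (Nat.le_succ t)) le_rfl
      have h2 := hσmeas t (by omega)
      have : K (t + 1) = fun ω => K t ω - σp (t + 1) ω := funext (hKrec t (by omega))
      rw [this]
      exact (Measurable.of_discrete (f := fun p : ℕ × ℕ => p.1 - p.2)).comp (h1.prodMk h2)
  have hKle : ∀ t, t ≤ n - 1 → ∀ ω, K t ω ≤ k := by
    intro t
    induction t with
    | zero => intro _ ω; exact (hK0 ω).le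
    | succ t ih =>
      intro ht ω
      rw [hKrec t (by omega)]
      exact (Nat.sub_le _ _).trans (ih (by omega) ω)
  have hRmeas : ∀ t, t ≤ n - 1 →
      Measurable[ℱ t] (fun ω => (K t ω : ℝ) / ((n : ℝ) - (t : ℝ))) := by
    intro t ht
    exact (measurable_from_top.comp (hKmeas t ht)).div_const _
  -- the event that the process has not been stopped by time `t`
  set A : ℕ → Set Ω := fun t => {ω | ∀ s ∈ Finset.range (t + 1),
    (K s ω : ℝ) / ((n : ℝ) - (s : ℝ)) ≤ 1} with hA
  have hAmeas : ∀ t, t ≤ n - 1 → MeasurableSet[ℱ t] (A t) := by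
    intro t ht
    have : A t = ⋂ s ∈ Finset.range (t + 1),
        {ω | (K s ω : ℝ) / ((n : ℝ) - (s : ℝ)) ≤ 1} := by
      ext ω; simp [hA]
    rw [this]
    refine Finset.measurableSet_biInter _ fun s hs => ?_
    have hs' : s ≤ t := by
      have := Finset.mem_range.1 hs
      omega
    exact ℱ.mono hs' _ (hRmeas s (by omega) measurableSet_Iic)
  have hτA : ∀ t, t < n - 1 → ∀ ω, t < τ₁ ω ↔ ω ∈ A t := by
    intro t ht ω
    rw [hτ₁ ω]
    constructor
    · intro h s hs
      by_contra hc
      push Not at hc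
      have hs' : s ≤ t := by
        have := Finset.mem_range.1 hs
        omega
      have := Nat.sInf_le (s := {t : ℕ | t = n - 1 ∨
        (t ≤ n - 1 ∧ 1 < (K t ω : ℝ) / ((n : ℝ) - (t : ℝ)))}) (m := s)
        (Or.inr ⟨by omega, hc⟩)
      omega
    · intro h
      have hmem := Nat.sInf_mem (s := {t : ℕ | t = n - 1 ∨
        (t ≤ n - 1 ∧ 1 < (K t ω : ℝ) / ((n : ℝ) - (t : ℝ)))}) ⟨n - 1, Or.inl rfl⟩
      by_contra hc
      push Not at hc
      rcases hmem with h1 | ⟨_, h2⟩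
      · omega
      · have := h _ (Finset.mem_range.2 (Nat.lt_succ_of_le hc))
        linarith
  set M : ℕ → Ω → ℝ := fun t ω =>
        (K (min (min t (n - 1)) (τ₁ ω)) ω : ℝ) /
          ((n : ℝ) - (min (min t (n - 1)) (τ₁ ω) : ℕ)) with hM
  have hstep : ∀ t, t < n - 1 → ∀ ω, M (t + 1) ω = M t ω + (A t).indicator (fun ω =>
      (K (t + 1) ω : ℝ) / ((n : ℝ) - ((t + 1 : ℕ) : ℝ)) -
        (K t ω : ℝ) / ((n : ℝ) - (t : ℝ))) ω := by
    intro t ht ω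
    by_cases h : ω ∈ A t
    · have h' := (hτA t ht ω).2 h
      have e1 : min (min (t + 1) (n - 1)) (τ₁ ω) = t + 1 := by omega
      have e2 : min (min t (n - 1)) (τ₁ ω) = t := by omega
      rw [Set.indicator_of_mem h]
      simp only [hM, e1, e2]
      ring
    · have h' := mt (hτA t ht ω).1 h
      have e1 : min (min (t + 1) (n - 1)) (τ₁ ω) = min (min t (n - 1)) (τ₁ ω) := by omega
      rw [Set.indicator_of_notMem h]
      simp only [hM, e1, add_zero]
  have hlate : ∀ t, n - 1 ≤ t → M (t + 1) = M t := by
    intro t ht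
    funext ω
    have e1 : min (min (t + 1) (n - 1)) (τ₁ ω) = min (min t (n - 1)) (τ₁ ω) := by omega
    simp only [hM, e1]
  have hMmeas : ∀ t, Measurable[ℱ t] (M t) := by
    intro t
    induction t with
    | zero =>
      have : M 0 = fun _ => (k : ℝ) / n := by
        funext ω
        simp [hM, hK0]
      rw [this]
      exact measurable_const
    | succ t ih =>
      have ih' : Measurable[ℱ (t + 1)] (M t) := ih.mono (ℱ.mono (Nat.le_succ t)) le_rfl
      by_cases ht : t < n - 1
      · rw [funext (hstep t ht)]
        refine ih'.add (Measurable.indicator ?_ (ℱ.mono (Nat.le_succ t) _ (hAmeas t (by omega))))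
        exact (hRmeas (t + 1) (by omega)).sub
          ((hRmeas t (by omega)).mono (ℱ.mono (Nat.le_succ t)) le_rfl)
      · rw [hlate t (by omega)]
        exact ih'
  have hbdd : ∀ s, s ≤ n - 1 → ∀ ω, ‖(K s ω : ℝ) / ((n : ℝ) - (s : ℝ))‖ ≤ k := by
    intro s hs ω
    have h1 := hden s hs
    have h2 : (K s ω : ℝ) ≤ k := by exact_mod_cast hKle s hs ω
    have h3 : (0 : ℝ) ≤ K s ω := Nat.cast_nonneg _
    rw [Real.norm_of_nonneg (by positivity)]
    exact (div_le_self h3 h1).trans h2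
  have hMint : ∀ t, Integrable (M t) μ := by
    intro t
    refine Integrable.of_bound ((hMmeas t).mono (ℱ.le t) le_rfl).aestronglyMeasurable (k : ℝ)
      (ae_of_all _ fun ω => ?_)
    exact hbdd _ ((min_le_left _ _).trans (min_le_right _ _)) ω
  refine martingale_of_condExp_sub_eq_zero_nat (fun t => (hMmeas t).stronglyMeasurable) hMint ?_
  intro t
  by_cases ht : t < n - 1
  swap
  · rw [hlate t (by omega), sub_self, condExp_zero]
  -- the compensated selection
  set g1 : Ω → ℝ := fun ω => min ((K t ω : ℝ) / ((n : ℝ) - (t : ℝ))) 1 with hg1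
  set s1 : Ω → ℝ := fun ω => (σp (t + 1) ω : ℝ) with hs1
  have hg1meas : Measurable[ℱ t] g1 := (hRmeas t ht.le).min measurable_const
  have hg1int : Integrable g1 μ := by
    refine Integrable.of_bound (hg1meas.mono (ℱ.le t) le_rfl).aestronglyMeasurable 1
      (ae_of_all _ fun ω => ?_)
    have h1 := hden t ht.le
    have h3 : (0 : ℝ) ≤ K t ω := Nat.cast_nonneg _
    rw [Real.norm_of_nonneg (le_min (by positivity) zero_le_one)]
    exact min_le_right _ _
  have hs1int : Integrable s1 μ := by
    have hm : Measurable[ℱ (t + 1)] s1 := measurable_from_top.comp (hσmeas t ht)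
    refine Integrable.of_bound (hm.mono (ℱ.le _) le_rfl).aestronglyMeasurable 1
      (ae_of_all _ fun ω => ?_)
    rw [Real.norm_of_nonneg (Nat.cast_nonneg _)]
    exact_mod_cast hσ01 (t + 1) ω
  have hgint : Integrable (g1 - s1) μ := hg1int.sub hs1int
  have hgcond : μ[g1 - s1 | ℱ t] =ᵐ[μ] 0 := by
    filter_upwards [condExp_sub hg1int hs1int (ℱ t), hcond t ht] with ω h1 h2
    rw [h1, Pi.sub_apply, condExp_of_stronglyMeasurable (ℱ.le t) hg1meas.stronglyMeasurable hg1int,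
      h2]
    simp [hg1]
  have hpull : ∀ (B : Set Ω) (c : ℝ), MeasurableSet[ℱ t] B →
      μ[B.indicator (fun _ => c) * (g1 - s1) | ℱ t] =ᵐ[μ] 0 := by
    intro B c hB
    have hm : StronglyMeasurable[ℱ t] (B.indicator (fun _ => c)) :=
      stronglyMeasurable_const.indicator hB
    filter_upwards [condExp_stronglyMeasurable_mul_of_bound (ℱ.le t) hm hgint ‖c‖
      (ae_of_all _ fun ω => norm_indicator_le_norm_self (fun _ => c) ω), hgcond] with ω h1 h2
    rw [h1, Pi.mul_apply, h2]
    simp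
  -- no selection without budget
  have hZ : MeasurableSet[ℱ t] {ω | K t ω = 0} :=
    hKmeas t ht.le (measurableSet_singleton 0)
  have hnosel : ∀ᵐ ω ∂μ, σp (t + 1) ω ≤ K t ω := by
    have hint : Integrable ({ω | K t ω = 0}.indicator s1) μ :=
      hs1int.indicator (ℱ.le t _ hZ)
    have heq : ({ω | K t ω = 0}.indicator (fun _ => (-1 : ℝ)) * (g1 - s1)) =
        {ω | K t ω = 0}.indicator s1 := by
      funext ω
      by_cases h : K t ω = 0
      · simp [Set.indicator, h, hg1]
      · simp [Set.indicator, h]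
    have hI : ∫ ω, {ω | K t ω = 0}.indicator s1 ω ∂μ = 0 := by
      rw [← integral_condExp (ℱ.le t), ← heq, integral_congr_ae (hpull _ (-1) hZ)]
      simp
    have h0 := (integral_eq_zero_iff_of_nonneg (fun ω => Set.indicator_nonneg
      (fun ω _ => Nat.cast_nonneg _) ω) hint).1 hI
    filter_upwards [h0] with ω hω
    by_cases h : K t ω = 0
    · have h2 : (σp (t + 1) ω : ℝ) = 0 := by
        simpa [Set.indicator, h, hs1] using hω
      have h3 : σp (t + 1) ω = 0 := by exact_mod_cast h2
      omega
    · have := hσ01 (t + 1) ω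
      omega
  have hinc : M (t + 1) - M t =ᵐ[μ]
      (A t).indicator (fun _ => ((n : ℝ) - ((t + 1 : ℕ) : ℝ))⁻¹) * (g1 - s1) := by
    filter_upwards [hnosel] with ω hω
    rw [Pi.sub_apply, hstep t ht ω, add_sub_cancel_left, Pi.mul_apply]
    by_cases h : ω ∈ A t
    · have hR : (K t ω : ℝ) / ((n : ℝ) - (t : ℝ)) ≤ 1 := h t (by simp)
      have d1 := hden t ht.le
      have d2 := hden (t + 1) ht
      rw [Set.indicator_of_mem h, Set.indicator_of_mem h, hKrec t ht, Nat.cast_sub hω]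
      simp only [Pi.sub_apply, hg1, hs1, min_eq_left hR]
      have n1 : (n : ℝ) - (t : ℝ) ≠ 0 := by positivity
      push_cast at d2 ⊢
      have n2 : (n : ℝ) - ((t : ℝ) + 1) ≠ 0 := by positivity
      field_simp
      ring
    · rw [Set.indicator_of_notMem h, Set.indicator_of_notMem h, zero_mul]
  exact (condExp_congr_ae hinc).trans (hpull _ _ (hAmeas t ht.le))

end MultiSecretary
end
end
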